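/- arXiv:1001.2193 — 3 statements merged into one kernel-verified Lean document; each statement's English description precedes it below -/
import Mathlib

section
/- Let Γ be a G-set with exactly two valleys, the y-valley (i_y,j_y) and the z-valley (i_z,k_z), such that Γ = span((i,j_y,0),(i,0,k_z),(i_y,j,0),(i_z,0,k)) with i = i(Γ), j = j(Γ), k = k(Γ). If j_y ≥ 1 and k_z ≥ 1 then TR(TUL(Γ)) = Γ, TUL(TR(Γ)) = Γ, TL(TUR(Γ)) = Γ and TUR(TL(Γ)) = Γ. Moreover, if j ≥ 2, k ≥ 2, j−j_y ≥ 2 and k−k_z ≥ 2, then TUL(TUR(Γ)) = TUR(TUL(Γ)). -/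
open scoped BigOperators Classical

namespace GH

/-- Exponent vectors of monomials `x^m y^n z^p`. -/
abbrev N3 : Type := ℕ × ℕ × ℕ

/-- The lattice `ℤ³`. -/
abbrev Z3 : Type := ℤ × ℤ × ℤ

/-- Inclusion `ℕ³ → ℤ³`. -/
def toZ (v : N3) : Z3 := ((v.1 : ℤ), (v.2.1 : ℤ), (v.2.2 : ℤ))

/-- The weight map `wt(m,n,p) = m + a·n + (r−a)·p (mod r)` on `ℤ³`. -/
def wtZ (r a : ℕ) (v : Z3) : ZMod r :=
  (v.1 : ZMod r) + (a : ZMod r) * (v.2.1 : ZMod r) + ((r - a : ℕ) : ZMod r) * (v.2.2 : ZMod r)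

/-- The weight map on `ℕ³`. -/
def wtN (r a : ℕ) (v : N3) : ZMod r := wtZ r a (toZ v)

/-- A `G`-set: contains the origin, closed under taking summands, and the weight map
restricted to it is a bijection onto `ℤ/rℤ`. -/
structure IsGSet (r a : ℕ) (Γ : Set N3) : Prop where
  zero_mem : (0, 0, 0) ∈ Γ
  dclosed : ∀ u v : N3, u + v ∈ Γ → u ∈ Γ ∧ v ∈ Γ
  bij : Set.BijOn (wtN r a) Γ Set.univ

/-- `wt_Γ(v)`: the (unique, for a `G`-set) element of `Γ` of the same weight as `v`. -/
noncomputable def wtG (r a : ℕ) (Γ : Set N3) (v : N3) : N3 :=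
  if h : ∃ w, w ∈ Γ ∧ wtN r a w = wtN r a v then h.choose else (0, 0, 0)

/-- `(m,n)` is a y-valley of `Γ`. -/
def IsYValley (Γ : Set N3) (m n : ℕ) : Prop :=
  (m, n, 0) ∈ Γ ∧ (m + 1, n, 0) ∈ Γ ∧ (m, n + 1, 0) ∈ Γ ∧ (m + 1, n + 1, 0) ∉ Γ

/-- `(m,n)` is a z-valley of `Γ`. -/
def IsZValley (Γ : Set N3) (m n : ℕ) : Prop :=
  (m, 0, n) ∈ Γ ∧ (m + 1, 0, n) ∈ Γ ∧ (m, 0, n + 1) ∈ Γ ∧ (m + 1, 0, n + 1) ∉ Γ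

/-- A primitive `G`-set: it has a y-valley `(i_y, 0)` and a z-valley `(i_z, 0)`. -/
def IsPrimG (Γ : Set N3) : Prop := (∃ p : ℕ, IsYValley Γ p 0) ∧ (∃ p : ℕ, IsZValley Γ p 0)

/-- `s_Γ(v) = v − wt_Γ(v) ∈ ℤ³`. -/
noncomputable def sG (r a : ℕ) (Γ : Set N3) (v : N3) : Z3 := toZ v - toZ (wtG r a Γ v)

/-- The submonoid `S(Γ)` of `ℤ³` generated by all `s_Γ(v)`. -/
noncomputable def SMon (r a : ℕ) (Γ : Set N3) : AddSubmonoid Z3 :=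
  AddSubmonoid.closure (Set.range (sG r a Γ))

/-- The lattice `M = { u ∈ ℤ³ : wt(u) = 0 }` of `G`-invariant monomials. -/
def latM (r a : ℕ) : Set Z3 := { u | wtZ r a u = 0 }

/-- The standard pairing of `ℝ³` with `ℤ³`. -/
def dotR (α : ℝ × ℝ × ℝ) (u : Z3) : ℝ :=
  α.1 * (u.1 : ℝ) + α.2.1 * (u.2.1 : ℝ) + α.2.2 * (u.2.2 : ℝ)

/-- The cone `σ(Γ) = { α ∈ ℝ³ : ⟨α, s_Γ(v)⟩ ≥ 0 for all v ∈ ℕ³ }`. -/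
noncomputable def sigmaCone (r a : ℕ) (Γ : Set N3) : Set (ℝ × ℝ × ℝ) :=
  { α | ∀ v : N3, 0 ≤ dotR α (sG r a Γ v) }

/-- `span(u₁,…,u_t)`: all `v ∈ ℕ³` dominated componentwise by some `u_s`. -/
def spanSet (s : Set N3) : Set N3 := { v | ∃ u ∈ s, v ≤ u }

/-- `i(Γ)`: the largest `m` with `(m,0,0) ∈ Γ`. -/
noncomputable def iOf (Γ : Set N3) : ℕ := sSup { m : ℕ | (m, 0, 0) ∈ Γ }

/-- `j(Γ)`: the largest `n` with `(0,n,0) ∈ Γ`. -/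
noncomputable def jOf (Γ : Set N3) : ℕ := sSup { n : ℕ | (0, n, 0) ∈ Γ }

/-- `k(Γ)`: the largest `p` with `(0,0,p) ∈ Γ`. -/
noncomputable def kOf (Γ : Set N3) : ℕ := sSup { p : ℕ | (0, 0, p) ∈ Γ }

/-- `c(w) = max { c : w − c·v ∈ ℕ³ }` (componentwise). -/
noncomputable def cmax (v w : N3) : ℕ := sSup { c : ℕ | c • v ≤ w }

/-- The `G`-igsaw transformation of `Γ` in the direction of `u`:
`T_u(Γ) = { w + c(w)·(u − v) : w ∈ Γ }` where `v = wt_Γ(u)`. -/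
noncomputable def jig (r a : ℕ) (Γ : Set N3) (u : N3) : Set N3 :=
  { w' | ∃ w ∈ Γ,
      toZ w' = toZ w + (cmax (wtG r a Γ u) w) • (toZ u - toZ (wtG r a Γ u)) }

/-- The upper transformation `TU(Γ)`. -/
noncomputable def TU (r a : ℕ) (Γ : Set N3) : Set N3 := jig r a Γ (iOf Γ + 1, 0, 0)

/-- The right transformation `TR(Γ)`. -/
noncomputable def TR (r a : ℕ) (Γ : Set N3) : Set N3 := jig r a Γ (0, jOf Γ + 1, 0)

/-- The left transformation `TL(Γ)`. -/
noncomputable def TL (r a : ℕ) (Γ : Set N3) : Set N3 := jig r a Γ (0, 0, kOf Γ + 1)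

/-- The y-valley of `Γ` (chosen by choice; unique for a `G`-set having one). -/
noncomputable def yValley (Γ : Set N3) : ℕ × ℕ :=
  if h : ∃ p : ℕ × ℕ, IsYValley Γ p.1 p.2 then h.choose else (0, 0)

/-- The z-valley of `Γ` (chosen by choice; unique for a `G`-set having one). -/
noncomputable def zValley (Γ : Set N3) : ℕ × ℕ :=
  if h : ∃ p : ℕ × ℕ, IsZValley Γ p.1 p.2 then h.choose else (0, 0)

/-- The upper right transformation `TUR(Γ)`, in the direction `(i_y+1, j_y+1, 0)`. -/
noncomputable def TUR (r a : ℕ) (Γ : Set N3) : Set N3 :=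
  jig r a Γ ((yValley Γ).1 + 1, (yValley Γ).2 + 1, 0)

/-- The upper left transformation `TUL(Γ)`, in the direction `(i_z+1, 0, k_z+1)`. -/
noncomputable def TUL (r a : ℕ) (Γ : Set N3) : Set N3 :=
  jig r a Γ ((zValley Γ).1 + 1, 0, (zValley Γ).2 + 1)

/-- The bound `min{j, k, j − j_y, k − k_z}` for the triangle of transformations. -/
noncomputable def minBound (Γ : Set N3) : ℕ :=
  min (min (jOf Γ) (kOf Γ)) (min (jOf Γ - (yValley Γ).2) (kOf Γ - (zValley Γ).2))

/-- The triangle of transformations `Θ(Γ)`. -/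
noncomputable def Theta (r a : ℕ) (Γ : Set N3) : Set (Set N3) :=
  { Γ' | ∃ p q : ℕ, p + q ≤ minBound Γ ∧ Γ' = (TUR r a)^[p] ((TUL r a)^[q] Γ) }

/-- The recursion step producing `Γ_{n+1}` from `Γ_n`. -/
noncomputable def nextGamma (r a : ℕ) (Γ : Set N3) : Set N3 :=
  if jOf Γ < kOf Γ then TU r a ((TUR r a)^[jOf Γ] Γ)
  else TU r a ((TUL r a)^[kOf Γ] Γ)

/-- The sequence of primitive `G`-sets; `GammaSeq r a b (n-1)` is `Γ_n`,
starting from `Γ₁ = span((1,0,0),(0,b−1,0),(0,0,r−b−1))`. -/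
noncomputable def GammaSeq (r a b : ℕ) : ℕ → Set N3
  | 0 => spanSet {(1, 0, 0), (0, b - 1, 0), (0, 0, r - b - 1)}
  | n + 1 => nextGamma r a (GammaSeq r a b n)

theorem mem_spanSet_four {i b c p j q k x y z : ℕ} :
    (x, y, z) ∈ spanSet {(i, b, 0), (i, 0, c), (p, j, 0), (q, 0, k)} ↔
      (x ≤ i ∧ y ≤ b ∧ z = 0) ∨ (x ≤ i ∧ y = 0 ∧ z ≤ c) ∨
      (x ≤ p ∧ y ≤ j ∧ z = 0) ∨ (x ≤ q ∧ y = 0 ∧ z ≤ k) := by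
  simp [spanSet, Prod.le_def]

theorem wtN_eq {r a : ℕ} (har : a ≤ r) (x y z : ℕ) :
    wtN r a (x, y, z) = (x : ZMod r) + a * y - a * z := by
  simp [wtN, wtZ, toZ, Nat.cast_sub har]
  ring

theorem wtG_eq {r a : ℕ} {Γ : Set N3} (hinj : Set.InjOn (wtN r a) Γ) {u v : N3}
    (hv : v ∈ Γ) (huv : wtN r a v = wtN r a u) : wtG r a Γ u = v := by
  have h : ∃ w, w ∈ Γ ∧ wtN r a w = wtN r a u := ⟨v, hv, huv⟩
  rw [wtG, dif_pos h]
  exact hinj h.choose_spec.1 hv (h.choose_spec.2.trans huv.symm)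

theorem cmax_eq_one {v w : N3} (h : v ≤ w) (h2 : ¬ 2 • v ≤ w) : cmax v w = 1 := by
  have hs : {c : ℕ | c • v ≤ w} = Set.Iic 1 := by
    ext c
    simp only [Set.mem_ofPred_eq, Set.mem_Iic]
    constructor
    · intro hc
      by_contra! hlt
      exact h2 ((nsmul_le_nsmul_left (zero_le (a := v)) hlt).trans hc)
    · intro hc
      interval_cases c
      · simp
      · simpa using h
  rw [cmax, hs, csSup_Iic]

theorem cmax_eq_zero {v w : N3} (h : ¬ v ≤ w) : cmax v w = 0 := by
  have hs : {c : ℕ | c • v ≤ w} = Set.Iic 0 := by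
    ext c
    simp only [Set.mem_ofPred_eq, Set.mem_Iic, Nat.le_zero]
    constructor
    · intro hc
      by_contra hne
      refine h (le_trans ?_ hc)
      simpa using nsmul_le_nsmul_left (zero_le (a := v)) (Nat.one_le_iff_ne_zero.2 hne)
    · rintro rfl
      simp
  rw [cmax, hs, csSup_Iic]

/-- A `G`-igsaw transformation in which every element is moved at most once. -/
theorem mem_jig_iff {r a : ℕ} {Γ : Set N3} (hinj : Set.InjOn (wtN r a) Γ) {u v : N3}
    (hv : v ∈ Γ) (huv : wtN r a v = wtN r a u) (h2 : ∀ w ∈ Γ, ¬ 2 • v ≤ w) (w' : N3) :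
    w' ∈ jig r a Γ u ↔ (w' ∈ Γ ∧ ¬ v ≤ w') ∨ ∃ w ∈ Γ, v ≤ w ∧ w' + v = w + u := by
  simp only [jig, Set.mem_ofPred_eq, wtG_eq hinj hv huv]
  obtain ⟨x', y', z'⟩ := w'
  obtain ⟨xu, yu, zu⟩ := u
  obtain ⟨xv, yv, zv⟩ := v
  constructor
  · rintro ⟨⟨x, y, z⟩, hw, h⟩
    by_cases hle : ((xv, yv, zv) : N3) ≤ (x, y, z)
    · rw [cmax_eq_one hle (h2 _ hw)] at h
      refine Or.inr ⟨_, hw, hle, ?_⟩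
      simp only [toZ, one_smul, Prod.mk_add_mk, Prod.mk_sub_mk, Prod.mk.injEq] at h ⊢
      omega
    · rw [cmax_eq_zero hle] at h
      simp only [toZ, zero_smul, add_zero, Prod.mk.injEq, Nat.cast_inj] at h
      obtain ⟨rfl, rfl, rfl⟩ := h
      exact Or.inl ⟨hw, hle⟩
  · rintro (⟨hw, hle⟩ | ⟨⟨x, y, z⟩, hw, hle, h⟩)
    · exact ⟨_, hw, by simp [cmax_eq_zero hle]⟩
    · refine ⟨_, hw, ?_⟩
      rw [cmax_eq_one hle (h2 _ hw)]
      simp only [toZ, one_smul, Prod.mk_add_mk, Prod.mk_sub_mk, Prod.mk.injEq] at h ⊢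
      omega

theorem injOn_jig {r a : ℕ} (har : a ≤ r) {Γ : Set N3} (hinj : Set.InjOn (wtN r a) Γ) {u v : N3}
    (hv : v ∈ Γ) (huv : wtN r a v = wtN r a u) (h2 : ∀ w ∈ Γ, ¬ 2 • v ≤ w) :
    Set.InjOn (wtN r a) (jig r a Γ u) := by
  have key : ∀ w w' : N3, w' + v = w + u → wtN r a w' = wtN r a w := by
    rintro ⟨x, y, z⟩ ⟨x', y', z'⟩ h
    obtain ⟨xu, yu, zu⟩ := u
    obtain ⟨xv, yv, zv⟩ := v
    simp only [Prod.mk_add_mk, Prod.mk.injEq] at h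
    rw [wtN_eq har, wtN_eq har] at huv ⊢
    have h1 := congrArg (Nat.cast : ℕ → ZMod r) h.1
    have h2 := congrArg (Nat.cast : ℕ → ZMod r) h.2.1
    have h3 := congrArg (Nat.cast : ℕ → ZMod r) h.2.2
    push_cast at h1 h2 h3
    linear_combination h1 + a * h2 - a * h3 - huv
  intro w₁ h₁ w₂ h₂ h
  rw [mem_jig_iff hinj hv huv h2] at h₁ h₂
  rcases h₁ with ⟨h₁, hn₁⟩ | ⟨s₁, h₁, hl₁, e₁⟩ <;> rcases h₂ with ⟨h₂, hn₂⟩ | ⟨s₂, h₂, hl₂, e₂⟩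
  · exact hinj h₁ h₂ h
  · obtain rfl := hinj h₁ h₂ (h.trans (key _ _ e₂))
    exact absurd hl₂ hn₁
  · obtain rfl := hinj h₁ h₂ ((key _ _ e₁).symm.trans h)
    exact absurd hl₁ hn₂
  · obtain rfl := hinj h₁ h₂ ((key _ _ e₁).symm.trans (h.trans (key _ _ e₂)))
    exact add_right_cancel (e₁.trans e₂.symm)

/-- The span attached to a y-valley `(p, b)` and a z-valley `(q, c)` with `i = p + q + 1`,
including the degenerate cases `b = j` and `c = k`. -/
def valleySpan (p q b j c k : ℕ) : Set N3 :=
  spanSet {(p + q + 1, b, 0), (p + q + 1, 0, c), (p, j, 0), (q, 0, k)}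

theorem mem_valleySpan {p q b j c k x y z : ℕ} :
    (x, y, z) ∈ valleySpan p q b j c k ↔
      (x ≤ p + q + 1 ∧ y ≤ b ∧ z = 0) ∨ (x ≤ p + q + 1 ∧ y = 0 ∧ z ≤ c) ∨
      (x ≤ p ∧ y ≤ j ∧ z = 0) ∨ (x ≤ q ∧ y = 0 ∧ z ≤ k) :=
  mem_spanSet_four

theorem yValley_valleySpan {p q b j c k : ℕ} (hb : b < j) :
    yValley (valleySpan p q b j c k) = (p, b) := by
  have h : ∃ t : ℕ × ℕ, IsYValley (valleySpan p q b j c k) t.1 t.2 := by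
    refine ⟨(p, b), ?_⟩
    simp only [IsYValley, mem_valleySpan, and_true]
    omega
  rw [yValley, dif_pos h]
  have hs := h.choose_spec
  generalize h.choose = t at hs ⊢
  simp only [IsYValley, mem_valleySpan, and_true] at hs
  ext <;> dsimp only <;> omega

theorem zValley_valleySpan {p q b j c k : ℕ} (hc : c < k) :
    zValley (valleySpan p q b j c k) = (q, c) := by
  have h : ∃ t : ℕ × ℕ, IsZValley (valleySpan p q b j c k) t.1 t.2 := by
    refine ⟨(q, c), ?_⟩
    simp only [IsZValley, mem_valleySpan, true_and]
    omega
  rw [zValley, dif_pos h]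
  have hs := h.choose_spec
  generalize h.choose = t at hs ⊢
  simp only [IsZValley, mem_valleySpan, true_and] at hs
  ext <;> dsimp only <;> omega

theorem jOf_valleySpan {p q b j c k : ℕ} (hb : b ≤ j) : jOf (valleySpan p q b j c k) = j := by
  have hs : {n : ℕ | (0, n, 0) ∈ valleySpan p q b j c k} = Set.Iic j := by
    ext n
    simp only [Set.mem_ofPred_eq, mem_valleySpan, Set.mem_Iic, and_true]
    omega
  rw [jOf, hs, csSup_Iic]

theorem kOf_valleySpan {p q b j c k : ℕ} (hc : c ≤ k) : kOf (valleySpan p q b j c k) = k := by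
  have hs : {n : ℕ | (0, 0, n) ∈ valleySpan p q b j c k} = Set.Iic k := by
    ext n
    simp only [Set.mem_ofPred_eq, mem_valleySpan, Set.mem_Iic, true_and]
    omega
  rw [kOf, hs, csSup_Iic]

/-- The weight conditions satisfied by the span of a `G`-set with two valleys. -/
structure IsValleyData (r a p q b j c k : ℕ) : Prop where
  injOn : Set.InjOn (wtN r a) (valleySpan p q b j c k)
  wt_y : (p : ZMod r) + 1 + a * (b + 1 + k) = 0
  wt_z : (q : ZMod r) + 1 - a * (c + 1 + j) = 0

theorem TUR_valleySpan {r a p q b j c k : ℕ} (har : a ≤ r) (hb : b < j) (hc : c ≤ k)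
    (h : IsValleyData r a p q b j c (k + 1)) :
    TUR r a (valleySpan p q b j c (k + 1)) = valleySpan p q (b + 1) j c k ∧
      IsValleyData r a p q (b + 1) j c k := by
  have hv : ((0, 0, k + 1) : N3) ∈ valleySpan p q b j c (k + 1) := by
    rw [mem_valleySpan]; omega
  have huv : wtN r a (0, 0, k + 1) = wtN r a (p + 1, b + 1, 0) := by
    rw [wtN_eq har, wtN_eq har]
    have := h.wt_y
    push_cast at this ⊢
    linear_combination -this
  have h2 : ∀ w ∈ valleySpan p q b j c (k + 1), ¬ 2 • ((0, 0, k + 1) : N3) ≤ w := by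
    rintro ⟨x, y, z⟩ hw
    simp only [mem_valleySpan, Prod.smul_mk, smul_eq_mul, Prod.mk_le_mk] at hw ⊢
    omega
  have e : TUR r a (valleySpan p q b j c (k + 1)) = valleySpan p q (b + 1) j c k := by
    rw [TUR, yValley_valleySpan hb]
    ext ⟨x, y, z⟩
    rw [mem_jig_iff h.injOn hv huv h2]
    simp only [mem_valleySpan, Prod.exists, Prod.mk_le_mk, Prod.mk_add_mk, Prod.mk.injEq]
    constructor
    · rintro (h | ⟨x', y', z', h⟩) <;> omega
    · intro h
      by_cases hx : p + 1 ≤ x ∧ y = b + 1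
      · exact Or.inr ⟨x - (p + 1), 0, k + 1, by omega⟩
      · exact Or.inl (by omega)
  refine ⟨e, ?_, ?_, h.wt_z⟩
  · rw [← e, TUR, yValley_valleySpan hb]
    exact injOn_jig har h.injOn hv huv h2
  · have := h.wt_y
    push_cast at this ⊢
    linear_combination this

theorem TUL_valleySpan {r a p q b j c k : ℕ} (har : a ≤ r) (hb : b ≤ j) (hc : c < k)
    (h : IsValleyData r a p q b (j + 1) c k) :
    TUL r a (valleySpan p q b (j + 1) c k) = valleySpan p q b j (c + 1) k ∧
      IsValleyData r a p q b j (c + 1) k := by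
  have hv : ((0, j + 1, 0) : N3) ∈ valleySpan p q b (j + 1) c k := by
    rw [mem_valleySpan]; omega
  have huv : wtN r a (0, j + 1, 0) = wtN r a (q + 1, 0, c + 1) := by
    rw [wtN_eq har, wtN_eq har]
    have := h.wt_z
    push_cast at this ⊢
    linear_combination -this
  have h2 : ∀ w ∈ valleySpan p q b (j + 1) c k, ¬ 2 • ((0, j + 1, 0) : N3) ≤ w := by
    rintro ⟨x, y, z⟩ hw
    simp only [mem_valleySpan, Prod.smul_mk, smul_eq_mul, Prod.mk_le_mk] at hw ⊢
    omega
  have e : TUL r a (valleySpan p q b (j + 1) c k) = valleySpan p q b j (c + 1) k := by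
    rw [TUL, zValley_valleySpan hc]
    ext ⟨x, y, z⟩
    rw [mem_jig_iff h.injOn hv huv h2]
    simp only [mem_valleySpan, Prod.exists, Prod.mk_le_mk, Prod.mk_add_mk, Prod.mk.injEq]
    constructor
    · rintro (h | ⟨x', y', z', h⟩) <;> omega
    · intro h
      by_cases hx : q + 1 ≤ x ∧ z = c + 1
      · exact Or.inr ⟨x - (q + 1), j + 1, 0, by omega⟩
      · exact Or.inl (by omega)
  refine ⟨e, ?_, h.wt_y, ?_⟩
  · rw [← e, TUL, zValley_valleySpan hc]
    exact injOn_jig har h.injOn hv huv h2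
  · have := h.wt_z
    push_cast at this ⊢
    linear_combination this

theorem TR_valleySpan {r a p q b j c k : ℕ} (har : a ≤ r) (hb : b ≤ j) (hc : c < k)
    (h : IsValleyData r a p q b j (c + 1) k) :
    TR r a (valleySpan p q b j (c + 1) k) = valleySpan p q b (j + 1) c k ∧
      IsValleyData r a p q b (j + 1) c k := by
  have hv : ((q + 1, 0, c + 1) : N3) ∈ valleySpan p q b j (c + 1) k := by
    rw [mem_valleySpan]; omega
  have huv : wtN r a (q + 1, 0, c + 1) = wtN r a (0, j + 1, 0) := by
    rw [wtN_eq har, wtN_eq har]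
    have := h.wt_z
    push_cast at this ⊢
    linear_combination this
  have h2 : ∀ w ∈ valleySpan p q b j (c + 1) k, ¬ 2 • ((q + 1, 0, c + 1) : N3) ≤ w := by
    rintro ⟨x, y, z⟩ hw
    simp only [mem_valleySpan, Prod.smul_mk, smul_eq_mul, Prod.mk_le_mk] at hw ⊢
    omega
  have e : TR r a (valleySpan p q b j (c + 1) k) = valleySpan p q b (j + 1) c k := by
    rw [TR, jOf_valleySpan hb]
    ext ⟨x, y, z⟩
    rw [mem_jig_iff h.injOn hv huv h2]
    simp only [mem_valleySpan, Prod.exists, Prod.mk_le_mk, Prod.mk_add_mk, Prod.mk.injEq]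
    constructor
    · rintro (h | ⟨x', y', z', h⟩) <;> omega
    · intro h
      by_cases hy : y = j + 1
      · exact Or.inr ⟨x + (q + 1), 0, c + 1, by omega⟩
      · exact Or.inl (by omega)
  refine ⟨e, ?_, h.wt_y, ?_⟩
  · rw [← e, TR, jOf_valleySpan hb]
    exact injOn_jig har h.injOn hv huv h2
  · have := h.wt_z
    push_cast at this ⊢
    linear_combination this

theorem TL_valleySpan {r a p q b j c k : ℕ} (har : a ≤ r) (hb : b < j) (hc : c ≤ k)
    (h : IsValleyData r a p q (b + 1) j c k) :
    TL r a (valleySpan p q (b + 1) j c k) = valleySpan p q b j c (k + 1) ∧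
      IsValleyData r a p q b j c (k + 1) := by
  have hv : ((p + 1, b + 1, 0) : N3) ∈ valleySpan p q (b + 1) j c k := by
    rw [mem_valleySpan]; omega
  have huv : wtN r a (p + 1, b + 1, 0) = wtN r a (0, 0, k + 1) := by
    rw [wtN_eq har, wtN_eq har]
    have := h.wt_y
    push_cast at this ⊢
    linear_combination this
  have h2 : ∀ w ∈ valleySpan p q (b + 1) j c k, ¬ 2 • ((p + 1, b + 1, 0) : N3) ≤ w := by
    rintro ⟨x, y, z⟩ hw
    simp only [mem_valleySpan, Prod.smul_mk, smul_eq_mul, Prod.mk_le_mk] at hw ⊢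
    omega
  have e : TL r a (valleySpan p q (b + 1) j c k) = valleySpan p q b j c (k + 1) := by
    rw [TL, kOf_valleySpan hc]
    ext ⟨x, y, z⟩
    rw [mem_jig_iff h.injOn hv huv h2]
    simp only [mem_valleySpan, Prod.exists, Prod.mk_le_mk, Prod.mk_add_mk, Prod.mk.injEq]
    constructor
    · rintro (h | ⟨x', y', z', h⟩) <;> omega
    · intro h
      by_cases hz : z = k + 1
      · exact Or.inr ⟨x + (p + 1), b + 1, 0, by omega⟩
      · exact Or.inl (by omega)
  refine ⟨e, ?_, ?_, h.wt_z⟩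
  · rw [← e, TL, kOf_valleySpan hc]
    exact injOn_jig har h.injOn hv huv h2
  · have := h.wt_y
    push_cast at this ⊢
    linear_combination this

/-- The monomial just outside a valley has the weight of the last power of the opposite variable. -/
theorem valley_weight {R : Type*} [CommRing R] (α : R) {P : ℕ → ℕ → ℕ → Prop}
    (hd : ∀ {x y z x' y' z'}, P x y z → x' ≤ x → y' ≤ y → z' ≤ z → P x' y' z')
    (hinj : ∀ {x y z x' y' z' : ℕ}, P x y z → P x' y' z' →
      (x : R) + α * y - α * z = x' + α * y' - α * z' → x = x' ∧ y = y' ∧ z = z')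
    (hsurj : ∀ t : R, ∃ x y z : ℕ, P x y z ∧ (x : R) + α * y - α * z = t)
    {m n k : ℕ} (h₁ : P (m + 1) n 0) (h₂ : P m (n + 1) 0) (h₃ : ¬ P (m + 1) (n + 1) 0)
    (hk : P 0 0 k) (hk' : ¬ P 0 0 (k + 1)) :
    (m : R) + 1 + α * (n + 1 + k) = 0 := by
  obtain ⟨x, y, z, hP, hw⟩ := hsurj (m + 1 + α * (n + 1))
  rcases x with _ | x
  · rcases y with _ | y
    · have hzk : z ≤ k := by
        by_contra! hlt
        exact hk' (hd hP le_rfl le_rfl hlt)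
      rcases hzk.eq_or_lt with rfl | hlt
      · push_cast at hw
        linear_combination -hw
      · have := hinj (hd hk le_rfl le_rfl hlt : P 0 0 (z + 1)) h₁
          (by push_cast at hw ⊢; linear_combination hw)
        omega
    · have := hinj (hd hP le_rfl (Nat.le_succ y) le_rfl) h₁
        (by push_cast at hw ⊢; linear_combination hw)
      omega
  · obtain ⟨rfl, rfl, rfl⟩ := hinj (hd hP (Nat.le_succ x) le_rfl le_rfl) h₂
      (by push_cast at hw ⊢; linear_combination hw)
    exact absurd hP h₃

theorem lt_of_isYValley_of_isZValley {i p q b j c k : ℕ}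
    (hy : IsYValley (spanSet {(i, b, 0), (i, 0, c), (p, j, 0), (q, 0, k)}) p b)
    (hz : IsZValley (spanSet {(i, b, 0), (i, 0, c), (p, j, 0), (q, 0, k)}) q c)
    (hi : (i + 1, 0, 0) ∉ spanSet {(i, b, 0), (i, 0, c), (p, j, 0), (q, 0, k)}) :
    p < i ∧ q < i ∧ b < j ∧ c < k := by
  obtain ⟨-, hy₁, hy₂, hy₃⟩ := hy
  obtain ⟨-, hz₁, hz₂, hz₃⟩ := hz
  rw [mem_spanSet_four] at hi hy₁ hy₂ hy₃ hz₁ hz₂ hz₃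
  have hpi : p ≤ i ∧ q ≤ i := by clear hy₁ hy₂ hy₃ hz₁ hz₂ hz₃; omega
  have hp : p < i := by clear hi hy₂ hy₃ hz₁ hz₂ hz₃; omega
  have hq : q < i := by clear hi hy₁ hy₂ hy₃ hz₂ hz₃; omega
  have hb : b < j := by clear hi hy₁ hz₁ hz₂ hz₃; omega
  have hc : c < k := by clear hi hz₁ hy₁ hy₂ hy₃; omega
  exact ⟨hp, hq, hb, hc⟩

/-- The defining data of a `G`-set spanned by its two valleys. -/
theorem isValleyData_of_isGSet {r a : ℕ} (har : a ≤ r) {i p q b j c k : ℕ}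
    (hΓ : IsGSet r a (spanSet {(i, b, 0), (i, 0, c), (p, j, 0), (q, 0, k)}))
    (hp : p < i) (hq : q < i) (hb : b < j) (hc : c < k) :
    i = p + q + 1 ∧ IsValleyData r a p q b j c k := by
  have hinj : ∀ {x y z x' y' z' : ℕ},
      (x, y, z) ∈ spanSet {(i, b, 0), (i, 0, c), (p, j, 0), (q, 0, k)} →
      (x', y', z') ∈ spanSet {(i, b, 0), (i, 0, c), (p, j, 0), (q, 0, k)} →
      (x : ZMod r) + a * y - a * z = x' + a * y' - a * z' → x = x' ∧ y = y' ∧ z = z' := by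
    intro x y z x' y' z' h h' e
    have := hΓ.bij.injOn h h' (by rwa [wtN_eq har, wtN_eq har])
    simpa using this
  have hsurj : ∀ t : ZMod r, ∃ x y z : ℕ,
      (x, y, z) ∈ spanSet {(i, b, 0), (i, 0, c), (p, j, 0), (q, 0, k)} ∧
      (x : ZMod r) + a * y - a * z = t := by
    intro t
    obtain ⟨⟨x, y, z⟩, h, e⟩ := hΓ.bij.surjOn (Set.mem_univ t)
    exact ⟨x, y, z, h, by rwa [wtN_eq har] at e⟩
  simp only [mem_spanSet_four] at hinj hsurj
  have hy : (p : ZMod r) + 1 + a * (b + 1 + k) = 0 := by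
    refine valley_weight (a : ZMod r) ?_ hinj hsurj ?_ ?_ ?_ ?_ ?_
    · intros; omega
    all_goals omega
  have hz : (q : ZMod r) + 1 + -a * (c + 1 + j) = 0 := by
    refine valley_weight (-a : ZMod r) (P := fun x y z => (x ≤ i ∧ z ≤ b ∧ y = 0) ∨
      (x ≤ i ∧ z = 0 ∧ y ≤ c) ∨ (x ≤ p ∧ z ≤ j ∧ y = 0) ∨ (x ≤ q ∧ z = 0 ∧ y ≤ k))
      ?_ ?_ ?_ ?_ ?_ ?_ ?_ ?_
    · intros; omega
    · intro x y z x' y' z' h h' e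
      have := hinj h h' (by linear_combination e)
      omega
    · intro t
      obtain ⟨x, y, z, h, e⟩ := hsurj t
      exact ⟨x, z, y, h, by linear_combination e⟩
    all_goals omega
  have hi : i = p + q + 1 := by
    rcases lt_trichotomy i (p + q + 1) with hlt | heq | hgt
    · obtain ⟨s, rfl⟩ : ∃ s, i = p + s := ⟨i - p, by omega⟩
      obtain ⟨t, ht⟩ : ∃ t, p + s = t + q := ⟨p + s - q, by omega⟩
      have ht' := congrArg (Nat.cast : ℕ → ZMod r) ht
      push_cast at ht'
      obtain ⟨x, y, z, h, e⟩ := hsurj ((p + s : ℕ) + 1)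
      push_cast at e
      rcases x with _ | x
      · rcases z with _ | z
        · rcases le_total y (c + 1) with hle | hle
          · obtain ⟨d, hd⟩ := Nat.exists_eq_add_of_le hle
            have hd' := congrArg (Nat.cast : ℕ → ZMod r) hd
            push_cast at hd' e
            have := @hinj 0 0 d t j 0 (by omega) (by omega)
              (by push_cast; linear_combination e + a * hd' + hz + ht')
            omega
          · obtain ⟨d, rfl⟩ := Nat.exists_eq_add_of_le hle
            push_cast at e
            have := @hinj 0 d 0 t j 0 (by omega) (by omega)
              (by push_cast; linear_combination e + hz + ht')
            omega
        · obtain rfl : y = 0 := by omega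
          rcases le_total (z + 1) (b + 1) with hle | hle
          · obtain ⟨d, hd⟩ := Nat.exists_eq_add_of_le hle
            have hd' := congrArg (Nat.cast : ℕ → ZMod r) hd
            push_cast at hd' e
            have := @hinj 0 d 0 s 0 k (by omega) (by omega)
              (by push_cast; linear_combination e - a * hd' + hy)
            omega
          · obtain ⟨d, hd⟩ := Nat.exists_eq_add_of_le hle
            have hd' := congrArg (Nat.cast : ℕ → ZMod r) hd
            push_cast at hd' e
            have := @hinj 0 0 d s 0 k (by omega) (by omega)
              (by push_cast; linear_combination e + a * hd' + hy)
            omega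
      · have := @hinj x y z (p + s) 0 0 (by omega) (by omega)
          (by push_cast at e ⊢; linear_combination e)
        omega
    · exact heq
    · rcases le_total (j + c) (b + k) with hle | hle
      · obtain ⟨d, hd⟩ := Nat.exists_eq_add_of_le hle
        have hd' := congrArg (Nat.cast : ℕ → ZMod r) hd
        push_cast at hd'
        have := @hinj (p + q + 2) 0 0 0 0 d (by omega) (by omega)
          (by push_cast; linear_combination hy + hz - a * hd')
        omega
      · obtain ⟨d, hd⟩ := Nat.exists_eq_add_of_le hle
        have hd' := congrArg (Nat.cast : ℕ → ZMod r) hd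
        push_cast at hd'
        have := @hinj (p + q + 2) 0 0 0 d 0 (by omega) (by omega)
          (by push_cast; linear_combination hy + hz + a * hd')
        omega
  refine ⟨hi, ?_, hy, by linear_combination hz⟩
  subst hi
  exact hΓ.bij.injOn

/-- Right and upper left (resp. left and upper right) transformations are inverse to
each other, and upper transformations commute. -/
theorem stmt12 (r a : ℕ) (hra : Nat.Coprime r a) (ha2 : 2 ≤ a) (halt : a < r - a) (Γ : Set N3) (hΓ : IsGSet r a Γ)
    (iy jy iz kz : ℕ)
    (hyv : IsYValley Γ iy jy) (hzv : IsZValley Γ iz kz)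
    (hyu : ∀ m n : ℕ, IsYValley Γ m n → (m, n) = (iy, jy))
    (hzu : ∀ m n : ℕ, IsZValley Γ m n → (m, n) = (iz, kz))
    (i j k : ℕ)
    (hi : (i, 0, 0) ∈ Γ ∧ (i + 1, 0, 0) ∉ Γ)
    (hj : (0, j, 0) ∈ Γ ∧ (0, j + 1, 0) ∉ Γ)
    (hk : (0, 0, k) ∈ Γ ∧ (0, 0, k + 1) ∉ Γ)
    (hspan : Γ = spanSet {(i, jy, 0), (i, 0, kz), (iy, j, 0), (iz, 0, k)}) :
    (1 ≤ jy ∧ 1 ≤ kz →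
      TR r a (TUL r a Γ) = Γ ∧ TUL r a (TR r a Γ) = Γ ∧
      TL r a (TUR r a Γ) = Γ ∧ TUR r a (TL r a Γ) = Γ) ∧
    (2 ≤ j ∧ 2 ≤ k ∧ 2 ≤ j - jy ∧ 2 ≤ k - kz →
      TUL r a (TUR r a Γ) = TUR r a (TUL r a Γ)) := by
  have har : a ≤ r := by omega
  subst hspan
  obtain ⟨hp, hq, hb, hc⟩ := lt_of_isYValley_of_isZValley hyv hzv hi.2
  obtain ⟨rfl, h⟩ := isValleyData_of_isGSet har hΓ hp hq hb hc
  change (_ → TR r a (TUL r a (valleySpan iy iz jy j kz k)) = valleySpan iy iz jy j kz k ∧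
    TUL r a (TR r a (valleySpan iy iz jy j kz k)) = valleySpan iy iz jy j kz k ∧
    TL r a (TUR r a (valleySpan iy iz jy j kz k)) = valleySpan iy iz jy j kz k ∧
    TUR r a (TL r a (valleySpan iy iz jy j kz k)) = valleySpan iy iz jy j kz k) ∧
    (_ → TUL r a (TUR r a (valleySpan iy iz jy j kz k)) =
      TUR r a (TUL r a (valleySpan iy iz jy j kz k)))
  obtain ⟨j, rfl⟩ : ∃ j', j = j' + 1 := ⟨j - 1, by omega⟩
  obtain ⟨k, rfl⟩ : ∃ k', k = k' + 1 := ⟨k - 1, by omega⟩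
  obtain ⟨eR, hR⟩ := TUR_valleySpan har hb (by omega) h
  obtain ⟨eL, hL⟩ := TUL_valleySpan har (by omega) hc h
  refine ⟨fun ⟨hb1, hc1⟩ => ⟨?_, ?_, ?_, ?_⟩, fun ⟨_, _, hb2, hc2⟩ => ?_⟩
  · rw [eL, (TR_valleySpan har (by omega) hc hL).1]
  · obtain ⟨kz, rfl⟩ : ∃ n, kz = n + 1 := ⟨kz - 1, by omega⟩
    obtain ⟨e, h'⟩ := TR_valleySpan har hb.le (by omega) h
    rw [e, (TUL_valleySpan har hb.le (by omega) h').1]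
  · rw [eR, (TL_valleySpan har hb (by omega) hR).1]
  · obtain ⟨jy, rfl⟩ : ∃ n, jy = n + 1 := ⟨jy - 1, by omega⟩
    obtain ⟨e, h'⟩ := TL_valleySpan har (by omega) hc.le h
    rw [e, (TUR_valleySpan har (by omega) hc.le h').1]
  · rw [eR, eL, (TUL_valleySpan har (by omega) (by omega) hR).1,
      (TUR_valleySpan har (by omega) (by omega) hL).1]

end GH
end

section
/- Let Γ be a G-set with exactly two valleys, the y-valley (i_y,j_y) and the z-valley (i_z,k_z), such that Γ = span((i,j_y,0),(i,0,k_z),(i_y,j,0),(i_z,0,k)) with i = i(Γ), j = j(Γ), k = k(Γ). Let m, n ∈ ℕ with m + n ≤ min{j, k, j−j_y, k−k_z}, and set Γ' = TUR^m(TUL^n(Γ)). Then Γ' = span((i,j_y+m,0),(i,0,k_z+n),(i_y,j−n,0),(i_z,0,k−m)). Moreover, if m + n < min{j, k, j−j_y, k−k_z} then Γ' has exactly two valleys, and if m + n = min{j, k, j−j_y, k−k_z} then Γ' has exactly one valley. -/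
open scoped BigOperators Classical

namespace GH

/-- The set spanned by the four monomials `x^i y^jy`, `x^i z^kz`, `x^iy y^j`, `x^iz z^k`. -/
def region (i iy iz jy j kz k : ℕ) : Set N3 :=
  spanSet {(i, jy, 0), (i, 0, kz), (iy, j, 0), (iz, 0, k)}

theorem mem_region {i iy iz jy j kz k p q s : ℕ} :
    (p, q, s) ∈ region i iy iz jy j kz k ↔
      (p ≤ i ∧ q ≤ jy ∧ s = 0) ∨ (p ≤ i ∧ q = 0 ∧ s ≤ kz) ∨
      (p ≤ iy ∧ q ≤ j ∧ s = 0) ∨ (p ≤ iz ∧ q = 0 ∧ s ≤ k) := by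
  simp [region, spanSet, Prod.mk_le_mk]

theorem spanSet_dclosed (s : Set N3) (u v : N3) (h : u + v ∈ spanSet s) :
    u ∈ spanSet s ∧ v ∈ spanSet s := by
  obtain ⟨w, hw, hle⟩ := h
  exact ⟨⟨w, hw, le_self_add.trans hle⟩, ⟨w, hw, le_add_self.trans hle⟩⟩

theorem toZ_injective : Function.Injective toZ := by
  rintro ⟨p, q, s⟩ ⟨p', q', s'⟩ h
  simpa [toZ] using h

theorem wtN_mk {r a : ℕ} (har : a ≤ r) (p q s : ℕ) :
    wtN r a (p, q, s) = (p : ZMod r) + a * q - a * s := by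
  simp [wtN, wtZ, toZ, Nat.cast_sub har]
  ring

theorem wtN_add (r a : ℕ) (u v : N3) : wtN r a (u + v) = wtN r a u + wtN r a v := by
  simp [wtN, wtZ, toZ]
  ring

namespace IsGSet

variable {r a : ℕ} {Γ : Set N3}

theorem mem_of_le (hΓ : IsGSet r a Γ) {u v : N3} (hv : v ∈ Γ) (h : u ≤ v) : u ∈ Γ :=
  (hΓ.dclosed u (v - u) (by rwa [add_tsub_cancel_of_le h])).1

theorem wtG_mem (hΓ : IsGSet r a Γ) (v : N3) : wtG r a Γ v ∈ Γ := by
  have h : ∃ w, w ∈ Γ ∧ wtN r a w = wtN r a v := hΓ.bij.surjOn (Set.mem_univ _)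
  simpa [wtG, h] using h.choose_spec.1

theorem wtN_wtG (hΓ : IsGSet r a Γ) (v : N3) : wtN r a (wtG r a Γ v) = wtN r a v := by
  have h : ∃ w, w ∈ Γ ∧ wtN r a w = wtN r a v := hΓ.bij.surjOn (Set.mem_univ _)
  simpa [wtG, h] using h.choose_spec.2

/-- Beyond a z-valley, the weight is that of the last power of `y` in `Γ`. -/
theorem wtG_zValley (hΓ : IsGSet r a Γ) (har : a ≤ r) {p s j : ℕ} (hz : IsZValley Γ p s)
    (hj : (0, j, 0) ∈ Γ) (hj' : (0, j + 1, 0) ∉ Γ) :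
    wtG r a Γ (p + 1, 0, s + 1) = (0, j, 0) := by
  obtain ⟨-, hz1, hz2, hz3⟩ := hz
  have hmem := hΓ.wtG_mem (p + 1, 0, s + 1)
  have hwt := hΓ.wtN_wtG (p + 1, 0, s + 1)
  generalize wtG r a Γ (p + 1, 0, s + 1) = w at hmem hwt ⊢
  obtain ⟨x, y, z⟩ := w
  rw [wtN_mk har, wtN_mk har] at hwt
  push_cast at hwt
  rcases x with _ | x
  · rcases z with _ | z
    · have hy : y ≤ j := by
        by_contra! hy
        exact hj' (hΓ.mem_of_le hmem (by simp [Prod.mk_le_mk]; omega))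
      rcases hy.eq_or_lt with rfl | hy
      · rfl
      have h : ((0, y + 1, 0) : N3) = (p + 1, 0, s) := by
        refine hΓ.bij.injOn (hΓ.mem_of_le hj (by simp [Prod.mk_le_mk]; omega)) hz1 ?_
        rw [wtN_mk har, wtN_mk har]
        push_cast at hwt ⊢
        linear_combination hwt
      simp at h
    · have h : ((0, y, z) : N3) = (p + 1, 0, s) := by
        refine hΓ.bij.injOn (hΓ.mem_of_le hmem (by simp [Prod.mk_le_mk])) hz1 ?_
        rw [wtN_mk har, wtN_mk har]
        push_cast at hwt ⊢
        linear_combination hwt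
      simp at h
  · have h : ((x, y, z) : N3) = (p, 0, s + 1) := by
      refine hΓ.bij.injOn (hΓ.mem_of_le hmem (by simp [Prod.mk_le_mk])) hz2 ?_
      rw [wtN_mk har, wtN_mk har]
      push_cast at hwt ⊢
      linear_combination hwt
    simp only [Prod.mk.injEq] at h
    obtain ⟨rfl, rfl, rfl⟩ := h
    exact absurd hmem hz3

/-- Beyond a y-valley, the weight is that of the last power of `z` in `Γ`. -/
theorem wtG_yValley (hΓ : IsGSet r a Γ) (har : a ≤ r) {p s k : ℕ} (hy : IsYValley Γ p s)
    (hk : (0, 0, k) ∈ Γ) (hk' : (0, 0, k + 1) ∉ Γ) :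
    wtG r a Γ (p + 1, s + 1, 0) = (0, 0, k) := by
  obtain ⟨-, hy1, hy2, hy3⟩ := hy
  have hmem := hΓ.wtG_mem (p + 1, s + 1, 0)
  have hwt := hΓ.wtN_wtG (p + 1, s + 1, 0)
  generalize wtG r a Γ (p + 1, s + 1, 0) = w at hmem hwt ⊢
  obtain ⟨x, y, z⟩ := w
  rw [wtN_mk har, wtN_mk har] at hwt
  push_cast at hwt
  rcases x with _ | x
  · rcases y with _ | y
    · have hz : z ≤ k := by
        by_contra! hz
        exact hk' (hΓ.mem_of_le hmem (by simp [Prod.mk_le_mk]; omega))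
      rcases hz.eq_or_lt with rfl | hz
      · rfl
      have h : ((0, 0, z + 1) : N3) = (p + 1, s, 0) := by
        refine hΓ.bij.injOn (hΓ.mem_of_le hk (by simp [Prod.mk_le_mk]; omega)) hy1 ?_
        rw [wtN_mk har, wtN_mk har]
        push_cast at hwt ⊢
        linear_combination hwt
      simp at h
    · have h : ((0, y, z) : N3) = (p + 1, s, 0) := by
        refine hΓ.bij.injOn (hΓ.mem_of_le hmem (by simp [Prod.mk_le_mk])) hy1 ?_
        rw [wtN_mk har, wtN_mk har]
        push_cast at hwt ⊢
        linear_combination hwt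
      simp at h
  · have h : ((x, y, z) : N3) = (p, s + 1, 0) := by
      refine hΓ.bij.injOn (hΓ.mem_of_le hmem (by simp [Prod.mk_le_mk])) hy2 ?_
      rw [wtN_mk har, wtN_mk har]
      push_cast at hwt ⊢
      linear_combination hwt
    simp only [Prod.mk.injEq] at h
    obtain ⟨rfl, rfl, rfl⟩ := h
    exact absurd hmem hy3

end IsGSet

/-- If no element of `Γ` is divisible by the square of the monomial `v = wt_Γ(u)`, then the
transformation in direction `u` replaces each multiple `w` of `v` in `Γ` by `w - v + u`. -/
theorem mem_jig {r a : ℕ} {Γ : Set N3} {u v : N3} (hv : wtG r a Γ u = v)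
    (h2 : ∀ w ∈ Γ, ¬ 2 • v ≤ w) (w' : N3) :
    w' ∈ jig r a Γ u ↔ (w' ∈ Γ ∧ ¬ v ≤ w') ∨ ∃ w, w + v ∈ Γ ∧ w' = w + u := by
  have toZ_add : ∀ x y : N3, toZ (x + y) = toZ x + toZ y := fun x y => by simp [toZ]
  subst hv
  constructor
  · rintro ⟨w, hw, h⟩
    by_cases hle : wtG r a Γ u ≤ w
    · right
      obtain ⟨t, rfl⟩ := exists_add_of_le hle
      refine ⟨t, by rwa [add_comm], toZ_injective ?_⟩
      rw [h, cmax_eq_one hle (h2 _ hw), toZ_add, toZ_add]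
      module
    · left
      rw [cmax_eq_zero hle, zero_smul, add_zero] at h
      rw [toZ_injective h]
      exact ⟨hw, hle⟩
  · rintro (⟨hw, hle⟩ | ⟨w, hw, rfl⟩)
    · exact ⟨w', hw, by rw [cmax_eq_zero hle, zero_smul, add_zero]⟩
    · refine ⟨_, hw, ?_⟩
      rw [cmax_eq_one le_add_self (h2 _ hw), toZ_add, toZ_add]
      module

theorem IsGSet.bijOn_jig {r a : ℕ} {Γ : Set N3} (hΓ : IsGSet r a Γ) {u v : N3}
    (hv : wtG r a Γ u = v) (h2 : ∀ w ∈ Γ, ¬ 2 • v ≤ w) :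
    Set.BijOn (wtN r a) (jig r a Γ u) Set.univ := by
  have hwt : wtN r a v = wtN r a u := hv ▸ hΓ.wtN_wtG u
  refine ⟨Set.mapsTo_univ _ _, ?_, fun x _ => ?_⟩
  · intro x hx y hy hxy
    rw [mem_jig hv h2] at hx hy
    rcases hx with ⟨hx, hx'⟩ | ⟨x, hx, rfl⟩ <;> rcases hy with ⟨hy, hy'⟩ | ⟨y, hy, rfl⟩
    · exact hΓ.bij.injOn hx hy hxy
    · rw [wtN_add, ← hwt, ← wtN_add] at hxy
      exact absurd le_add_self (hΓ.bij.injOn hx hy hxy ▸ hx')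
    · rw [wtN_add, ← hwt, ← wtN_add] at hxy
      exact absurd le_add_self (hΓ.bij.injOn hx hy hxy ▸ hy')
    · rw [wtN_add, wtN_add, ← hwt, ← wtN_add, ← wtN_add] at hxy
      rw [add_right_cancel (hΓ.bij.injOn hx hy hxy)]
  · obtain ⟨w, hw, rfl⟩ := hΓ.bij.surjOn (Set.mem_univ x)
    by_cases hle : v ≤ w
    · obtain ⟨t, rfl⟩ := exists_add_of_le hle
      refine ⟨t + u, (mem_jig hv h2 _).2 (Or.inr ⟨t, by rwa [add_comm], rfl⟩), ?_⟩
      rw [wtN_add, wtN_add, hwt, add_comm]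
    · exact ⟨w, (mem_jig hv h2 _).2 (Or.inl ⟨hw, hle⟩), rfl⟩

section Region

variable {r a i iy iz jy j kz k : ℕ}

theorem isYValley_region_iff (hiy : iy < i) (hiz : iz < i) {p q : ℕ} :
    IsYValley (region i iy iz jy j kz k) p q ↔ jy < j ∧ p = iy ∧ q = jy := by
  simp only [IsYValley, mem_region, and_true]
  constructor <;> omega

theorem isZValley_region_iff (hiy : iy < i) (hiz : iz < i) {p q : ℕ} :
    IsZValley (region i iy iz jy j kz k) p q ↔ kz < k ∧ p = iz ∧ q = kz := by
  simp only [IsZValley, mem_region, true_and]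
  constructor <;> omega

theorem yValley_region (hiy : iy < i) (hiz : iz < i) (h : jy < j) :
    yValley (region i iy iz jy j kz k) = (iy, jy) := by
  have hex : ∃ p : ℕ × ℕ, IsYValley (region i iy iz jy j kz k) p.1 p.2 :=
    ⟨(iy, jy), (isYValley_region_iff hiy hiz).2 ⟨h, rfl, rfl⟩⟩
  have hs := (isYValley_region_iff hiy hiz).1 hex.choose_spec
  simpa [yValley, hex] using Prod.ext hs.2.1 hs.2.2

theorem zValley_region (hiy : iy < i) (hiz : iz < i) (h : kz < k) :
    zValley (region i iy iz jy j kz k) = (iz, kz) := by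
  have hex : ∃ p : ℕ × ℕ, IsZValley (region i iy iz jy j kz k) p.1 p.2 :=
    ⟨(iz, kz), (isZValley_region_iff hiy hiz).2 ⟨h, rfl, rfl⟩⟩
  have hs := (isZValley_region_iff hiy hiz).1 hex.choose_spec
  simpa [zValley, hex] using Prod.ext hs.2.1 hs.2.2

theorem isGSet_region_of_jig {Γ : Set N3} (hΓ : IsGSet r a Γ) {u v : N3}
    (hv : wtG r a Γ u = v) (h2 : ∀ w ∈ Γ, ¬ 2 • v ≤ w)
    (h : jig r a Γ u = region i iy iz jy j kz k) :
    IsGSet r a (region i iy iz jy j kz k) :=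
  ⟨by simp [mem_region], spanSet_dclosed _, h ▸ hΓ.bijOn_jig hv h2⟩

theorem TUL_region (hΓ : IsGSet r a (region i iy iz jy j kz k)) (har : a ≤ r)
    (hi : i = iy + iz + 1) (hjy : jy < j) (hkz : kz < k) :
    TUL r a (region i iy iz jy j kz k) = region i iy iz jy (j - 1) (kz + 1) k ∧
      IsGSet r a (region i iy iz jy (j - 1) (kz + 1) k) := by
  have hiy : iy < i := by omega
  have hiz : iz < i := by omega
  have hv : wtG r a (region i iy iz jy j kz k) (iz + 1, 0, kz + 1) = (0, j, 0) :=
    hΓ.wtG_zValley har ((isZValley_region_iff hiy hiz).2 ⟨hkz, rfl, rfl⟩)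
      (by simp [mem_region]) (by simp [mem_region]; omega)
  have h2 : ∀ w ∈ region i iy iz jy j kz k, ¬ 2 • ((0, j, 0) : N3) ≤ w := by
    rintro ⟨p, q, s⟩ hw
    rw [mem_region] at hw
    simp [Prod.mk_le_mk]
    omega
  have h : TUL r a (region i iy iz jy j kz k) = region i iy iz jy (j - 1) (kz + 1) k := by
    rw [TUL, zValley_region hiy hiz hkz]
    ext ⟨p, q, s⟩
    rw [mem_jig hv h2]
    simp only [Prod.exists, Prod.mk_add_mk, mem_region, Prod.mk_le_mk, Prod.mk.injEq]
    constructor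
    · rintro (h | ⟨p', q', s', h⟩) <;> omega
    · intro h
      by_cases hs : iz < p ∧ s = kz + 1
      · exact Or.inr ⟨p - (iz + 1), 0, 0, by omega⟩
      · exact Or.inl (by omega)
  exact ⟨h, isGSet_region_of_jig hΓ hv h2 (by rwa [TUL, zValley_region hiy hiz hkz] at h)⟩

theorem TUR_region (hΓ : IsGSet r a (region i iy iz jy j kz k)) (har : a ≤ r)
    (hi : i = iy + iz + 1) (hjy : jy < j) (hkz : kz < k) :
    TUR r a (region i iy iz jy j kz k) = region i iy iz (jy + 1) j kz (k - 1) ∧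
      IsGSet r a (region i iy iz (jy + 1) j kz (k - 1)) := by
  have hiy : iy < i := by omega
  have hiz : iz < i := by omega
  have hv : wtG r a (region i iy iz jy j kz k) (iy + 1, jy + 1, 0) = (0, 0, k) :=
    hΓ.wtG_yValley har ((isYValley_region_iff hiy hiz).2 ⟨hjy, rfl, rfl⟩)
      (by simp [mem_region]) (by simp [mem_region]; omega)
  have h2 : ∀ w ∈ region i iy iz jy j kz k, ¬ 2 • ((0, 0, k) : N3) ≤ w := by
    rintro ⟨p, q, s⟩ hw
    rw [mem_region] at hw
    simp [Prod.mk_le_mk]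
    omega
  have h : TUR r a (region i iy iz jy j kz k) = region i iy iz (jy + 1) j kz (k - 1) := by
    rw [TUR, yValley_region hiy hiz hjy]
    ext ⟨p, q, s⟩
    rw [mem_jig hv h2]
    simp only [Prod.exists, Prod.mk_add_mk, mem_region, Prod.mk_le_mk, Prod.mk.injEq]
    constructor
    · rintro (h | ⟨p', q', s', h⟩) <;> omega
    · intro h
      by_cases hs : iy < p ∧ q = jy + 1
      · exact Or.inr ⟨p - (iy + 1), 0, 0, by omega⟩
      · exact Or.inl (by omega)
  exact ⟨h, isGSet_region_of_jig hΓ hv h2 (by rwa [TUR, yValley_region hiy hiz hjy] at h)⟩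

theorem TUL_iterate_region (hΓ : IsGSet r a (region i iy iz jy j kz k)) (har : a ≤ r)
    (hi : i = iy + iz + 1) (n : ℕ) (hj : jy + n ≤ j) (hk : kz + n ≤ k) :
    (TUL r a)^[n] (region i iy iz jy j kz k) = region i iy iz jy (j - n) (kz + n) k ∧
      IsGSet r a (region i iy iz jy (j - n) (kz + n) k) := by
  induction n with
  | zero => exact ⟨rfl, hΓ⟩
  | succ n ih =>
    obtain ⟨h, hG⟩ := ih (by omega) (by omega)
    rw [Function.iterate_succ_apply', h]
    exact TUL_region hG har hi (by omega) (by omega)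

theorem TUR_iterate_region (hΓ : IsGSet r a (region i iy iz jy j kz k)) (har : a ≤ r)
    (hi : i = iy + iz + 1) (m : ℕ) (hj : jy + m ≤ j) (hk : kz + m ≤ k) :
    (TUR r a)^[m] (region i iy iz jy j kz k) = region i iy iz (jy + m) j kz (k - m) := by
  suffices h : (TUR r a)^[m] (region i iy iz jy j kz k) = region i iy iz (jy + m) j kz (k - m) ∧
      IsGSet r a (region i iy iz (jy + m) j kz (k - m)) from h.1
  induction m with
  | zero => exact ⟨rfl, hΓ⟩
  | succ m ih =>
    obtain ⟨h, hG⟩ := ih (by omega) (by omega)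
    rw [Function.iterate_succ_apply', h]
    exact TUR_region hG har hi (by omega) (by omega)

/-- The weights `a * t` with `-k ≤ t ≤ j` are attained on the `y`- and `z`-axes. -/
theorem exists_mem_axis (har : a ≤ r) (t : ℤ) (h1 : -k ≤ t) (h2 : t ≤ j) :
    ∃ y z : ℕ, (0, y, z) ∈ region i iy iz jy j kz k ∧ wtN r a (0, y, z) = a * t := by
  rcases le_total 0 t with h | h
  · lift t to ℕ using h
    exact ⟨t, 0, by simp [mem_region]; omega, by simp [wtN_mk har]⟩
  · obtain ⟨s, rfl⟩ := Int.exists_eq_neg_ofNat h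
    exact ⟨0, s, by simp [mem_region]; omega, by simp [wtN_mk har]⟩

/-- The weight relations `x^(iz+1) z^(kz+1) ~ y^j` and `x^(iy+1) y^(jy+1) ~ z^k` in a region
with two valleys, solved for the powers of `x`. -/
theorem wt_relations_region (hΓ : IsGSet r a (region i iy iz jy j kz k)) (har : a ≤ r)
    (hiy : iy < i) (hiz : iz < i) (hjy : jy < j) (hkz : kz < k) :
    (iz + 1 : ZMod r) = a * (j + kz + 1) ∧ (iy + 1 : ZMod r) = -(a * (k + jy + 1)) := by
  have hz := hΓ.wtN_wtG (iz + 1, 0, kz + 1)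
  rw [hΓ.wtG_zValley har (j := j) ((isZValley_region_iff hiy hiz).2 ⟨hkz, rfl, rfl⟩)
    (by simp [mem_region]) (by simp [mem_region]; omega), wtN_mk har, wtN_mk har] at hz
  have hy := hΓ.wtN_wtG (iy + 1, jy + 1, 0)
  rw [hΓ.wtG_yValley har (k := k) ((isYValley_region_iff hiy hiz).2 ⟨hjy, rfl, rfl⟩)
    (by simp [mem_region]) (by simp [mem_region]; omega), wtN_mk har, wtN_mk har] at hy
  push_cast at hy hz
  constructor
  · linear_combination -hz
  · linear_combination -hy

theorem eq_add_of_isGSet_region (hΓ : IsGSet r a (region i iy iz jy j kz k)) (har : a ≤ r)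
    (hiy : iy < i) (hiz : iz < i) (hjy : jy < j) (hkz : kz < k) : i = iy + iz + 1 := by
  obtain ⟨hz, hy⟩ := wt_relations_region hΓ har hiy hiz hjy hkz
  -- A monomial of `Γ` divisible by `x` does not have the weight of a signed axis power `y^t`.
  have key : ∀ (t : ℤ) (p y z : ℕ), 0 < p → (p, y, z) ∈ region i iy iz jy j kz k →
      wtN r a (p, y, z) = a * t → t < -k ∨ j < t := by
    intro t p y z hp hmem hwt
    by_contra! h
    obtain ⟨y', z', hmem', hwt'⟩ :=
      exists_mem_axis (iz := iz) (jy := jy) (kz := kz) har t h.1 h.2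
    have := hΓ.bij.injOn hmem hmem' (hwt.trans hwt'.symm)
    simp only [Prod.mk.injEq] at this
    omega
  by_contra hne
  rcases Nat.lt_or_gt_of_ne hne with hlt | hgt
  · have hmem := hΓ.wtG_mem (i + 1, 0, 0)
    have hwt := hΓ.wtN_wtG (i + 1, 0, 0)
    generalize wtG r a (region i iy iz jy j kz k) (i + 1, 0, 0) = w at hmem hwt
    obtain ⟨x, y, z⟩ := w
    rw [wtN_mk har, wtN_mk har] at hwt
    push_cast at hwt
    rcases x with _ | x
    · have h1 := key (y - z + jy + 1) (i - iy) 0 k (by omega) (by simp [mem_region]; omega) (by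
        rw [wtN_mk har, Nat.cast_sub hiy.le]
        push_cast at hwt ⊢
        linear_combination -hwt - hy)
      have h2 := key (y - z - kz - 1) (i - iz) j 0 (by omega) (by simp [mem_region]; omega) (by
        rw [wtN_mk har, Nat.cast_sub hiz.le]
        push_cast at hwt ⊢
        linear_combination -hwt - hz)
      rw [mem_region] at hmem
      omega
    · have h : ((x, y, z) : N3) = (i, 0, 0) := by
        refine hΓ.bij.injOn (hΓ.mem_of_le hmem (by simp [Prod.mk_le_mk]))
          (by simp [mem_region]) ?_
        rw [wtN_mk har, wtN_mk har]
        push_cast at hwt ⊢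
        linear_combination hwt
      simp only [Prod.mk.injEq] at h
      rw [mem_region] at hmem
      omega
  · have := key (j - jy + kz - k) (iy + iz + 2) 0 0 (by omega) (by simp [mem_region]; omega) (by
      rw [wtN_mk har]
      push_cast
      linear_combination hz + hy)
    omega

theorem sub_ne_sub_of_isGSet_region (hΓ : IsGSet r a (region i iy iz jy j kz k)) (har : a < r)
    (hiy : iy < i) (hiz : iz < i) (hjy : jy < j) (hkz : kz < k) : j - jy ≠ k - kz := by
  intro heq
  have hi := eq_add_of_isGSet_region hΓ har.le hiy hiz hjy hkz
  obtain ⟨hz, hy⟩ := wt_relations_region hΓ har.le hiy hiz hjy hkz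
  have hc : (j : ZMod r) + kz = k + jy := by
    exact_mod_cast congrArg (Nat.cast : ℕ → ZMod r) (by omega : j + kz = k + jy)
  have hr : ((i + 1 : ℕ) : ZMod r) = 0 := by
    subst hi
    push_cast
    linear_combination hz + hy + a * hc
  have hle := Nat.le_of_dvd (by omega) ((ZMod.natCast_eq_zero_iff _ _).1 hr)
  have h : ((a, 0, 0) : N3) = (0, 1, 0) :=
    hΓ.bij.injOn (by simp [mem_region]; omega) (by simp [mem_region]; omega)
      (by simp [wtN_mk har.le])
  simp at h

end Region

/-- Iterated upper transformations of a `G`-set with two valleys: explicit spanning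
monomials and the number of valleys of the result. -/
theorem stmt13 (r a : ℕ) (hra : Nat.Coprime r a) (ha2 : 2 ≤ a) (halt : a < r - a) (Γ : Set N3) (hΓ : IsGSet r a Γ)
    (iy jy iz kz : ℕ)
    (hyv : IsYValley Γ iy jy) (hzv : IsZValley Γ iz kz)
    (hyu : ∀ m n : ℕ, IsYValley Γ m n → (m, n) = (iy, jy))
    (hzu : ∀ m n : ℕ, IsZValley Γ m n → (m, n) = (iz, kz))
    (i j k : ℕ)
    (hi : (i, 0, 0) ∈ Γ ∧ (i + 1, 0, 0) ∉ Γ)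
    (hj : (0, j, 0) ∈ Γ ∧ (0, j + 1, 0) ∉ Γ)
    (hk : (0, 0, k) ∈ Γ ∧ (0, 0, k + 1) ∉ Γ)
    (hspan : Γ = spanSet {(i, jy, 0), (i, 0, kz), (iy, j, 0), (iz, 0, k)})
    (m n : ℕ) (hmn : m + n ≤ min (min j k) (min (j - jy) (k - kz))) :
    (TUR r a)^[m] ((TUL r a)^[n] Γ) =
      spanSet {(i, jy + m, 0), (i, 0, kz + n), (iy, j - n, 0), (iz, 0, k - m)} ∧
    (m + n < min (min j k) (min (j - jy) (k - kz)) →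
      (∃ p q : ℕ, IsYValley ((TUR r a)^[m] ((TUL r a)^[n] Γ)) p q) ∧
      (∃ p q : ℕ, IsZValley ((TUR r a)^[m] ((TUL r a)^[n] Γ)) p q)) ∧
    (m + n = min (min j k) (min (j - jy) (k - kz)) →
      ((∃ p q : ℕ, IsYValley ((TUR r a)^[m] ((TUL r a)^[n] Γ)) p q) ∧
        (∀ p q : ℕ, ¬ IsZValley ((TUR r a)^[m] ((TUL r a)^[n] Γ)) p q)) ∨
      ((∀ p q : ℕ, ¬ IsYValley ((TUR r a)^[m] ((TUL r a)^[n] Γ)) p q) ∧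
        (∃ p q : ℕ, IsZValley ((TUR r a)^[m] ((TUL r a)^[n] Γ)) p q))) := by
  have har : a < r := by omega
  have hΓr : Γ = region i iy iz jy j kz k := hspan
  have hiy : iy < i := by
    by_contra! h
    exact hi.2 (hΓ.mem_of_le hyv.2.1 (by simp [Prod.mk_le_mk]; omega))
  have hiz : iz < i := by
    by_contra! h
    exact hi.2 (hΓ.mem_of_le hzv.2.1 (by simp [Prod.mk_le_mk]; omega))
  rw [hΓr] at hΓ hyv hzv ⊢
  have hjy := ((isYValley_region_iff hiy hiz).1 hyv).1
  have hkz := ((isZValley_region_iff hiy hiz).1 hzv).1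
  have hi' := eq_add_of_isGSet_region hΓ har.le hiy hiz hjy hkz
  have hne := sub_ne_sub_of_isGSet_region hΓ har hiy hiz hjy hkz
  obtain ⟨hL, hG⟩ := TUL_iterate_region hΓ har.le hi' n (by omega) (by omega)
  have hR := TUR_iterate_region hG har.le hi' m (by omega) (by omega)
  rw [hL, hR]
  refine ⟨rfl, fun hlt => ⟨⟨iy, jy + m, ?_⟩, ⟨iz, kz + n, ?_⟩⟩, fun heq => ?_⟩
  · exact (isYValley_region_iff hiy hiz).2 ⟨by omega, rfl, rfl⟩
  · exact (isZValley_region_iff hiy hiz).2 ⟨by omega, rfl, rfl⟩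
  · simp only [isYValley_region_iff hiy hiz, isZValley_region_iff hiy hiz]
    rcases Nat.lt_or_gt_of_ne hne with h | h
    · exact Or.inr ⟨fun p q hpq => by omega, iz, kz + n, by omega, rfl, rfl⟩
    · exact Or.inl ⟨⟨iy, jy + m, by omega, rfl, rfl⟩, fun p q hpq => by omega⟩

end GH
end

section
/- Let b be the unique integer with 1 ≤ b ≤ r−1 and a·b ≡ 1 (mod r); note that 2 ≤ a < r−a forces 2 ≤ b ≤ r−2. Then Γ₁ = span((1,0,0),(0,b−1,0),(0,0,r−b−1)) is a G-set, and (0,0) is both a y-valley and a z-valley of Γ₁; in particular Γ₁ is primitive. -/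
open scoped BigOperators Classical

namespace GH

theorem mem_spanSet_axes {q s : ℕ} {v : N3} :
    v ∈ spanSet {(1, 0, 0), (0, q, 0), (0, 0, s)} ↔
      (v.1 ≤ 1 ∧ v.2.1 = 0 ∧ v.2.2 = 0) ∨ (v.1 = 0 ∧ v.2.1 ≤ q ∧ v.2.2 = 0) ∨
        (v.1 = 0 ∧ v.2.1 = 0 ∧ v.2.2 ≤ s) := by
  simp [spanSet, Prod.le_def]

/-- If `b` is inverse to `a` modulo `r`, every weight is `a` times a linear form. -/
theorem wtN_eq_mul {r a b : ℕ} (har : a ≤ r) (hab : (a : ZMod r) * b = 1) (v : N3) :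
    wtN r a v = a * (((v.1 : ℤ) * b + v.2.1 - v.2.2 : ℤ) : ZMod r) := by
  simp only [wtN, wtZ, toZ]
  push_cast [Nat.cast_sub har]
  rw [ZMod.natCast_self]
  linear_combination (-(v.1 : ZMod r)) * hab

theorem wtN_bijOn_spanSet_axes {r a b : ℕ} (har : a ≤ r) (hb : 1 ≤ b) (hbr : b < r)
    (hab : (a : ZMod r) * b = 1) :
    Set.BijOn (wtN r a) (spanSet {(1, 0, 0), (0, b - 1, 0), (0, 0, r - b - 1)}) Set.univ := by
  have : NeZero r := ⟨by omega⟩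
  refine ⟨fun _ _ => Set.mem_univ _, ?_, ?_⟩
  · rintro ⟨m, n, p⟩ hv ⟨m', n', p'⟩ hw h
    rw [mem_spanSet_axes] at hv hw
    rw [wtN_eq_mul har hab, wtN_eq_mul har hab] at h
    have h2 := congrArg (fun x => (b : ZMod r) * x) h
    simp only [← mul_assoc, mul_comm (b : ZMod r) a, hab, one_mul] at h2
    rw [ZMod.intCast_eq_intCast_iff_dvd_sub] at h2
    simp only at hv hw
    have key : ((m' : ℤ) * b + n' - p') - (m * b + n - p) = 0 := by
      apply Int.eq_zero_of_abs_lt_dvd h2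
      have hm : m = 0 ∨ m = 1 := by omega
      have hm' : m' = 0 ∨ m' = 1 := by omega
      rw [abs_lt]
      rcases hm with rfl | rfl <;> rcases hm' with rfl | rfl <;> push_cast <;> omega
    have hm : m = 0 ∨ m = 1 := by omega
    have hm' : m' = 0 ∨ m' = 1 := by omega
    simp only [Prod.mk.injEq]
    rcases hm with rfl | rfl <;> rcases hm' with rfl | rfl <;> push_cast at key <;> omega
  · intro c _
    set t := ((b : ZMod r) * c).val with ht
    have htr : t < r := ZMod.val_lt _
    have hc : (a : ZMod r) * (t : ZMod r) = c := by
      rw [ht, ZMod.natCast_zmod_val, ← mul_assoc, hab, one_mul]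
    rcases lt_trichotomy t b with h | h | h
    · refine ⟨(0, t, 0), mem_spanSet_axes.2 (by simp; omega), ?_⟩
      rw [wtN_eq_mul har hab, ← hc]
      simp
    · refine ⟨(1, 0, 0), mem_spanSet_axes.2 (by simp), ?_⟩
      rw [wtN_eq_mul har hab, ← hc, h]
      simp
    · refine ⟨(0, 0, r - t), mem_spanSet_axes.2 (by simp; omega), ?_⟩
      rw [wtN_eq_mul har hab, ← hc]
      simp [Nat.cast_sub htr.le]

/-- `Γ₁ = span((1,0,0),(0,b−1,0),(0,0,r−b−1))` is a `G`-set, and `(0,0)` is both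
its y-valley and its z-valley; in particular `Γ₁` is primitive. -/
theorem stmt16 (r a : ℕ) (hra : Nat.Coprime r a) (ha2 : 2 ≤ a) (halt : a < r - a) (b : ℕ) (hb1 : 1 ≤ b) (hb2 : b ≤ r - 1)
    (hab : a * b ≡ 1 [MOD r]) :
    IsGSet r a (spanSet {(1, 0, 0), (0, b - 1, 0), (0, 0, r - b - 1)}) ∧
    IsYValley (spanSet {(1, 0, 0), (0, b - 1, 0), (0, 0, r - b - 1)}) 0 0 ∧
    IsZValley (spanSet {(1, 0, 0), (0, b - 1, 0), (0, 0, r - b - 1)}) 0 0 ∧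
    IsPrimG (spanSet {(1, 0, 0), (0, b - 1, 0), (0, 0, r - b - 1)}) := by
  have hab' : (a : ZMod r) * b = 1 := by
    exact_mod_cast (ZMod.natCast_eq_natCast_iff _ _ _).2 hab
  have hb_ne_one : b ≠ 1 := by
    rintro rfl
    have h : a % r = 1 % r := by simpa [Nat.ModEq] using hab
    rw [Nat.mod_eq_of_lt (by omega), Nat.mod_eq_of_lt (by omega)] at h
    omega
  have hb_ne_pred : b ≠ r - 1 := by
    rintro rfl
    have h : ((a + 1 : ℕ) : ZMod r) = 0 := by
      rw [Nat.cast_sub (by omega), ZMod.natCast_self] at hab'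
      push_cast at hab' ⊢
      linear_combination -hab'
    have := Nat.le_of_dvd (by omega) ((ZMod.natCast_eq_zero_iff _ _).1 h)
    omega
  have hy : IsYValley (spanSet {(1, 0, 0), (0, b - 1, 0), (0, 0, r - b - 1)}) 0 0 := by
    simp [IsYValley, mem_spanSet_axes]
    omega
  have hz : IsZValley (spanSet {(1, 0, 0), (0, b - 1, 0), (0, 0, r - b - 1)}) 0 0 := by
    simp [IsZValley, mem_spanSet_axes]
    omega
  refine ⟨⟨mem_spanSet_axes.2 (by simp), ?_, ?_⟩, hy, hz, ⟨0, hy⟩, ⟨0, hz⟩⟩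
  · rintro u v ⟨w, hw, huv⟩
    exact ⟨⟨w, hw, le_self_add.trans huv⟩, ⟨w, hw, le_add_self.trans huv⟩⟩
  · exact wtN_bijOn_spanSet_axes (by omega) hb1 (by omega) hab'

end GH
end
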